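/- Let μ be a Borel probability measure on ℝ with cumulative distribution function F(y) = μ((−∞, y]) and quantile function Q(τ) = inf{y ∈ ℝ : F(y) ≥ τ}. For K ≥ 1, define the empirical CDF built from the K quantiles at levels τ_k = k/(K+1): F̂_K(y) = (1/K)·#{k ∈ {1,…,K} : Q(k/(K+1)) ≤ y}. Then sup_{y ∈ ℝ} |F̂_K(y) − F(y)| ≤ 2/K; in particular, F̂_K converges to F uniformly on ℝ as K → ∞. -/

import Mathlib

open MeasureTheory Filter
open scoped Classical

/-- The quantile function of a Borel (probability) measure `μ` on `ℝ`:
`Q(τ) = inf {y : F(y) ≥ τ}` where `F(y) = μ((-∞, y])` is the CDF. -/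
noncomputable def quantile (μ : Measure ℝ) (τ : ℝ) : ℝ :=
  sInf {y : ℝ | τ ≤ (μ (Set.Iic y)).toReal}

/-- The empirical CDF built from the `K` quantiles of `μ` at levels `τ_k = k/(K+1)`,
`k = 1, …, K`: `F̂_K(y) = (1/K) · #{k : Q(k/(K+1)) ≤ y}`. -/
noncomputable def empiricalCDF (μ : Measure ℝ) (K : ℕ) (y : ℝ) : ℝ :=
  ((Finset.Icc 1 K).filter fun k => quantile μ ((k : ℝ) / (K + 1)) ≤ y).card / (K : ℝ)

/-- The Galois relation between the quantile function and the cumulative distribution function. -/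
theorem quantile_le_iff (μ : Measure ℝ) [IsProbabilityMeasure μ] {τ : ℝ} (h0 : 0 < τ)
    (h1 : τ < 1) (y : ℝ) : quantile μ τ ≤ y ↔ τ ≤ (μ (Set.Iic y)).toReal := by
  have hF (x : ℝ) : (μ (Set.Iic x)).toReal = ProbabilityTheory.cdf μ x :=
    (ProbabilityTheory.cdf_eq_real μ x).symm
  simp only [quantile, hF]
  have hmono := ProbabilityTheory.monotone_cdf μ
  obtain ⟨b, hb⟩ :=
    ((ProbabilityTheory.tendsto_cdf_atBot μ).eventually (gt_mem_nhds h0)).exists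
  obtain ⟨t, ht⟩ :=
    ((ProbabilityTheory.tendsto_cdf_atTop μ).eventually (lt_mem_nhds h1)).exists
  have hbdd : BddBelow {x : ℝ | τ ≤ ProbabilityTheory.cdf μ x} :=
    ⟨b, fun x hx => (hmono.reflect_lt (hb.trans_le hx)).le⟩
  refine ⟨fun h => ?_, fun h => csInf_le hbdd h⟩
  have hright : Tendsto (ProbabilityTheory.cdf μ) (nhdsWithin y (Set.Ioi y))
      (nhds (ProbabilityTheory.cdf μ y)) :=
    ((ProbabilityTheory.cdf μ).right_continuous y).mono_left
      (nhdsWithin_mono y Set.Ioi_subset_Ici_self)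
  refine ge_of_tendsto hright (eventually_nhdsWithin_of_forall fun z hz => ?_)
  obtain ⟨s, hs, hsz⟩ := exists_lt_of_csInf_lt ⟨t, ht.le⟩ (h.trans_lt hz)
  exact le_trans hs (hmono hsz.le)

/-- The number of quantiles below `y` is determined by the integer part of `(K + 1) F(y)`. -/
theorem empiricalCDF_eq_min_floor (μ : Measure ℝ) [IsProbabilityMeasure μ] (K : ℕ) (y : ℝ) :
    empiricalCDF μ K y =
      (min K ⌊((K : ℝ) + 1) * (μ (Set.Iic y)).toReal⌋₊ : ℕ) / (K : ℝ) := by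
  have hK : (0 : ℝ) < K + 1 := by positivity
  rw [empiricalCDF]
  congr 2
  rw [← Nat.add_sub_cancel (min K _) 1, ← Nat.card_Icc,
    ← Finset.card_image_of_injective _ (Nat.cast_injective (R := ℝ))]
  congr 1
  ext x
  simp only [Finset.bind_def, Finset.pure_def, Finset.mem_filter, Finset.mem_sup,
    Finset.mem_singleton, Finset.mem_image, Finset.mem_Icc, le_min_iff]
  have level_iff {k : ℕ} (hk : 1 ≤ k) (hkK : k ≤ K) :
      quantile μ ((k : ℝ) / (K + 1)) ≤ y ↔ k ≤ ⌊((K : ℝ) + 1) * (μ (Set.Iic y)).toReal⌋₊ := by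
    have hk' : (0 : ℝ) < k := by exact_mod_cast hk
    have hkK' : (k : ℝ) < K + 1 := by exact_mod_cast Nat.lt_succ_of_le hkK
    rw [quantile_le_iff μ (div_pos hk' hK) ((div_lt_one hK).2 hkK'), div_le_iff₀' hK,
      Nat.le_floor_iff (by positivity)]
  constructor
  · rintro ⟨⟨k, ⟨hk, hkK⟩, rfl⟩, hq⟩
    exact ⟨k, ⟨hk, hkK, (level_iff hk hkK).1 hq⟩, rfl⟩
  · rintro ⟨k, ⟨hk, hkK, hq⟩, rfl⟩
    exact ⟨⟨k, ⟨hk, hkK⟩, rfl⟩, (level_iff hk hkK).2 hq⟩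

theorem abs_empiricalCDF_sub_le (μ : Measure ℝ) [IsProbabilityMeasure μ] {K : ℕ} (hK : 1 ≤ K)
    (y : ℝ) : |empiricalCDF μ K y - (μ (Set.Iic y)).toReal| ≤ 2 / (K : ℝ) := by
  rw [empiricalCDF_eq_min_floor]
  have hF0 : 0 ≤ (μ (Set.Iic y)).toReal := ENNReal.toReal_nonneg
  have hF1 : (μ (Set.Iic y)).toReal ≤ 1 := measureReal_le_one
  generalize (μ (Set.Iic y)).toReal = F at hF0 hF1 ⊢
  have hK' : (0 : ℝ) < K := by exact_mod_cast hK
  have hle := Nat.floor_le (a := ((K : ℝ) + 1) * F) (by positivity)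
  have hlt := Nat.lt_floor_add_one (((K : ℝ) + 1) * F)
  have hKF : (K : ℝ) * F ≤ K := mul_le_of_le_one_right hK'.le hF1
  rw [div_sub' hK'.ne', abs_div, abs_of_pos hK']
  gcongr
  rw [abs_le]
  rcases le_total K ⌊((K : ℝ) + 1) * F⌋₊ with h | h
  · rw [min_eq_left h]
    have h' : (K : ℝ) ≤ ⌊((K : ℝ) + 1) * F⌋₊ := by exact_mod_cast h
    constructor <;> linarith
  · rw [min_eq_right h]
    constructor <;> linarith

/-- **Finite quantile embedding.** The empirical CDF built from `K` quantiles at levels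
`k/(K+1)` approximates the true CDF uniformly: `sup_y |F̂_K(y) − F(y)| ≤ 2/K`, and in
particular `F̂_K → F` uniformly on `ℝ` as `K → ∞`. -/
theorem empiricalCDF_uniform_approx (μ : Measure ℝ) [IsProbabilityMeasure μ] :
    (∀ K : ℕ, 1 ≤ K → ∀ y : ℝ,
        |empiricalCDF μ K y - (μ (Set.Iic y)).toReal| ≤ 2 / (K : ℝ))
      ∧ TendstoUniformly (fun K : ℕ => empiricalCDF μ K)
          (fun y => (μ (Set.Iic y)).toReal) atTop := by
  refine ⟨fun K hK y => abs_empiricalCDF_sub_le μ hK y, ?_⟩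
  rw [Metric.tendstoUniformly_iff]
  intro ε hε
  filter_upwards [(tendsto_const_div_atTop_nhds_zero_nat (2 : ℝ)).eventually (gt_mem_nhds hε),
    eventually_ge_atTop 1] with K hKε hK y
  rw [dist_comm, Real.dist_eq]
  exact (abs_empiricalCDF_sub_le μ hK y).trans_lt hKε
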